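/- For q ≥ 4, the set {B_1, B_2, B_3, B_4} with B_1 = [I_q, J_q − I_q], B_2 = [E_{1,1}−E_{2,2}, N−Nᵀ, N+Nᵀ−2(E_{1,1}−E_{2,2})], B_3 = [E_{1,2}+E_{2,3}+E_{3,1}−E_{2,1}−E_{3,2}−E_{1,3}], B_4 = [E_{1,3}−E_{3,2}+E_{2,4}−E_{4,1}+E_{3,1}−E_{2,3}+E_{4,2}−E_{1,4}] is a representative set for the natural action of S_q on ℝ^{q×q}; in particular, the spans ℝS_q·B_i(j) are irreducible S_q-modules, and ℝS_q·B_i(j) ≅ ℝS_q·B_i(j') while ℝS_q·B_i(j) ≇ ℝS_q·B_{i'}(j') for i ≠ i'. -/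

import Mathlib

open Finset

section RepSet

variable (G : Type*) [Group G] [Fintype G]
variable {α : Type*} [Fintype α] [DecidableEq α] [MulAction G α]

/-- The action of `g ∈ G` on functions `ℝ^α`, `(g·f)(a) = f (g⁻¹·a)`. -/
def actF (g : G) (f : α → ℝ) : α → ℝ := fun a => f (g⁻¹ • a)

/-- A `G`-invariant subspace of `ℝ^α`. -/
def IsInvt (p : Submodule ℝ (α → ℝ)) : Prop := ∀ g : G, ∀ f ∈ p, actF G g f ∈ p

/-- `ℝG·v`, the `G`-module generated by `v`. -/
def orbSpan (v : α → ℝ) : Submodule ℝ (α → ℝ) :=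
  Submodule.span ℝ (Set.range fun g : G => actF G g v)

/-- A `G`-equivariant linear endomorphism of `ℝ^α`. -/
def IsEquivar (φ : (α → ℝ) →ₗ[ℝ] (α → ℝ)) : Prop :=
  ∀ (g : G) (f : α → ℝ), φ (actF G g f) = actF G g (φ f)

/-- A representative matrix set for the action of `G` on `ℝ^α`, given by its
columns `u i j` (`i < k`, `j < m i`): each `ℝG·(u i j)` is a nonzero irreducible
`G`-module; for fixed `i` the modules `ℝG·(u i j)` are `G`-isomorphic via an
isomorphism mapping `u i j` to `u i j'`; modules with different `i` are not
`G`-isomorphic; and `ℝ^α` is the (internal) direct sum of all the `ℝG·(u i j)`. -/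
def IsRepresentativeSet {k : ℕ} {m : Fin k → ℕ}
    (u : (i : Fin k) → Fin (m i) → (α → ℝ)) : Prop :=
  (∀ i j, u i j ≠ 0) ∧
  (∀ i j, ∀ p : Submodule ℝ (α → ℝ), IsInvt G p → p ≤ orbSpan G (u i j) →
    p = ⊥ ∨ p = orbSpan G (u i j)) ∧
  (∀ i j j', ∃ φ : (α → ℝ) →ₗ[ℝ] (α → ℝ), IsEquivar G φ ∧
    φ (u i j) = u i j' ∧
    Set.InjOn φ (orbSpan G (u i j)) ∧
    Submodule.map φ (orbSpan G (u i j)) = orbSpan G (u i j')) ∧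
  (∀ i i', i ≠ i' → ∀ j j',
    ¬ ∃ φ : (α → ℝ) →ₗ[ℝ] (α → ℝ), IsEquivar G φ ∧
      Set.InjOn φ (orbSpan G (u i j)) ∧
      Submodule.map φ (orbSpan G (u i j)) = orbSpan G (u i' j')) ∧
  iSupIndep (fun p : Σ i : Fin k, Fin (m i) => orbSpan G (u p.1 p.2)) ∧
  (⨆ p : Σ i : Fin k, Fin (m i), orbSpan G (u p.1 p.2)) = ⊤

end RepSet

section Columns

variable (q : ℕ)

/-- `E_{i,j} = e_i e_jᵀ` viewed as a vector in `ℝ^{q×q}` (0-based indices). -/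
def Ecol (i j : ℕ) : Fin q × Fin q → ℝ :=
  fun p => if (p.1 : ℕ) = i ∧ (p.2 : ℕ) = j then 1 else 0

/-- `N = (e₁ − e₂)𝟏ᵀ` viewed as a vector in `ℝ^{q×q}`. -/
def Ncol : Fin q × Fin q → ℝ :=
  fun p => if (p.1 : ℕ) = 0 then 1 else if (p.1 : ℕ) = 1 then -1 else 0

/-- `B₁ = [I_q, J_q − I_q]`, `B₂ = [E₁₁−E₂₂, N−Nᵀ, N+Nᵀ−2(E₁₁−E₂₂)]`,
`B₃ = [E₁₂+E₂₃+E₃₁−E₂₁−E₃₂−E₁₃]`,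
`B₄ = [E₁₃−E₃₂+E₂₄−E₄₁+E₃₁−E₂₃+E₄₂−E₁₄]` (all written with 0-based indices),
with the columns of `B_i` viewed as vectors in `ℝ^{q×q}`. -/
def uCols : (i : Fin 4) → Fin (![2, 3, 1, 1] i) → (Fin q × Fin q → ℝ)
  | ⟨0, _⟩ => ![(fun p => if p.1 = p.2 then 1 else 0),
      (fun p => if p.1 = p.2 then 0 else 1)]
  | ⟨1, _⟩ => ![Ecol q 0 0 - Ecol q 1 1,
      (fun p => Ncol q p - Ncol q (p.2, p.1)),
      (fun p => Ncol q p + Ncol q (p.2, p.1)) - 2 • (Ecol q 0 0 - Ecol q 1 1)]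
  | ⟨2, _⟩ => ![Ecol q 0 1 + Ecol q 1 2 + Ecol q 2 0
      - Ecol q 1 0 - Ecol q 2 1 - Ecol q 0 2]
  | ⟨3, _⟩ => ![Ecol q 0 2 - Ecol q 2 1 + Ecol q 1 3 - Ecol q 3 0
      + Ecol q 2 0 - Ecol q 1 2 + Ecol q 3 1 - Ecol q 0 3]

end Columns

section Helpers

variable {q : ℕ}

/-- The symmetric group acting. -/
abbrev SG (q : ℕ) := Equiv.Perm (Fin q)
/-- The space of matrices. -/
abbrev VV (q : ℕ) := Fin q × Fin q → ℝ

/-- The action as a linear map. -/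
def actL (g : SG q) : VV q →ₗ[ℝ] VV q where
  toFun := actF (SG q) g
  map_add' _ _ := rfl
  map_smul' _ _ := rfl

lemma actL_apply (g : SG q) (f : VV q) : actL g f = actF (SG q) g f := rfl

lemma actF_apply (g : SG q) (f : VV q) (i j : Fin q) :
    actF (SG q) g f (i, j) = f (g⁻¹ i, g⁻¹ j) := rfl

lemma actF_mul (g h : SG q) (f : VV q) :
    actF (SG q) g (actF (SG q) h f) = actF (SG q) (g * h) f := by
  funext ⟨i, j⟩
  simp [actF_apply]

lemma actF_one (f : VV q) : actF (SG q) 1 f = f := by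
  funext ⟨i, j⟩
  simp [actF_apply]

lemma dot_act (g : SG q) (f h : VV q) :
    actF (SG q) g f ⬝ᵥ h = f ⬝ᵥ actF (SG q) g⁻¹ h := by
  simp only [dotProduct, Fintype.sum_prod_type, actF_apply, inv_inv]
  rw [← Equiv.sum_comp g]
  refine Finset.sum_congr rfl fun i _ => ?_
  rw [← Equiv.sum_comp g]
  simp

lemma orbSpan_le {v : VV q} {P : Submodule ℝ (VV q)} (hP : IsInvt (SG q) P) (hv : v ∈ P) :
    orbSpan (SG q) v ≤ P := by
  refine Submodule.span_le.2 ?_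
  rintro _ ⟨g, rfl⟩
  exact hP g _ hv

lemma act_mem_orbSpan (g : SG q) (v : VV q) : actF (SG q) g v ∈ orbSpan (SG q) v :=
  Submodule.subset_span ⟨g, rfl⟩

lemma self_mem_orbSpan (v : VV q) : v ∈ orbSpan (SG q) v := by
  have := act_mem_orbSpan 1 v
  rwa [actF_one] at this

lemma orbSpan_invt (v : VV q) : IsInvt (SG q) (orbSpan (SG q) v) := by
  intro g f hf
  have : orbSpan (SG q) v ≤ (orbSpan (SG q) v).comap (actL g) := by
    refine Submodule.span_le.2 ?_
    rintro _ ⟨h, rfl⟩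
    change actF (SG q) g (actF (SG q) h v) ∈ orbSpan (SG q) v
    rw [actF_mul]
    exact act_mem_orbSpan _ _
  exact this hf

/-- Operators behaving like elements of the group algebra. -/
def Good (T : VV q →ₗ[ℝ] VV q) : Prop :=
  (∀ φ : VV q →ₗ[ℝ] VV q, IsEquivar (SG q) φ → ∀ f, φ (T f) = T (φ f)) ∧
  (∀ p : Submodule ℝ (VV q), IsInvt (SG q) p → ∀ f ∈ p, T f ∈ p)

lemma Good.one : Good (1 : VV q →ₗ[ℝ] VV q) := ⟨fun _ _ _ => rfl, fun _ _ _ h => h⟩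

lemma Good.act (g : SG q) : Good (actL g) :=
  ⟨fun _ h f => h g f, fun _ hp f hf => hp g f hf⟩

lemma Good.add {S T : VV q →ₗ[ℝ] VV q} (hS : Good S) (hT : Good T) : Good (S + T) :=
  ⟨fun φ h f => by simp [hS.1 φ h, hT.1 φ h],
   fun p hp f hf => p.add_mem (hS.2 p hp f hf) (hT.2 p hp f hf)⟩

lemma Good.sub {S T : VV q →ₗ[ℝ] VV q} (hS : Good S) (hT : Good T) : Good (S - T) :=
  ⟨fun φ h f => by simp [hS.1 φ h, hT.1 φ h],
   fun p hp f hf => p.sub_mem (hS.2 p hp f hf) (hT.2 p hp f hf)⟩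

lemma dot_orb_zero {f v : VV q} (h : ∀ g, f ⬝ᵥ actF (SG q) g v = 0) {w : VV q}
    (hw : w ∈ orbSpan (SG q) v) : f ⬝ᵥ w = 0 := by
  induction hw using Submodule.span_induction with
  | mem x hx => obtain ⟨g, rfl⟩ := hx; exact h g
  | zero => simp
  | add x y _ _ hx hy => rw [dotProduct_add, hx, hy, add_zero]
  | smul a x _ hx => rw [dotProduct_smul, hx, smul_zero]

/-- The James submodule argument. -/
lemma irr {v : VV q} {T : VV q →ₗ[ℝ] VV q} (hT : Good T) {l : ℝ} (hl : l ≠ 0)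
    (hv : T v = l • v) (hs : ∀ f ∈ orbSpan (SG q) v, ∃ c : ℝ, T f = c • v)
    (sa : ∀ f h, T f ⬝ᵥ h = f ⬝ᵥ T h) (p : Submodule ℝ (VV q)) (hp : IsInvt (SG q) p)
    (hle : p ≤ orbSpan (SG q) v) : p = ⊥ ∨ p = orbSpan (SG q) v := by
  by_cases H : ∃ f ∈ p, T f ≠ 0
  · obtain ⟨f, hf, hf0⟩ := H
    right
    refine le_antisymm hle (orbSpan_le hp ?_)
    obtain ⟨c, hc⟩ := hs f (hle hf)
    have hc0 : c ≠ 0 := by rintro rfl; simp [hc] at hf0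
    have := p.smul_mem c⁻¹ (hT.2 p hp f hf)
    rwa [hc, smul_smul, inv_mul_cancel₀ hc0, one_smul] at this
  · push Not at H
    left
    rw [Submodule.eq_bot_iff]
    intro f hf
    have key : ∀ f ∈ p, f ⬝ᵥ v = 0 := by
      intro f hf
      have h1 := sa f v
      rw [H f hf, hv, zero_dotProduct, dotProduct_smul, smul_eq_mul] at h1
      exact (mul_eq_zero.1 h1.symm).resolve_left hl
    have h2 : f ⬝ᵥ f = 0 := by
      refine dot_orb_zero (v := v) (fun g => ?_) (hle hf)
      have h3 := key _ (hp g⁻¹ f hf)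
      rwa [dot_act, inv_inv] at h3
    exact dotProduct_self_eq_zero.1 h2

lemma iso_aux {u u' : VV q} {φ ψ : VV q →ₗ[ℝ] VV q} (hφ : IsEquivar (SG q) φ)
    (hψ : IsEquivar (SG q) ψ) (h1 : φ u = u') (h2 : ψ u' = u) :
    ∃ φ : VV q →ₗ[ℝ] VV q, IsEquivar (SG q) φ ∧ φ u = u' ∧
    Set.InjOn φ (orbSpan (SG q) u) ∧
    Submodule.map φ (orbSpan (SG q) u) = orbSpan (SG q) u' := by
  refine ⟨φ, hφ, h1, ?_, ?_⟩
  · have h3 : ∀ f ∈ orbSpan (SG q) u, ψ (φ f) = f := by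
      intro f hf
      induction hf using Submodule.span_induction with
      | mem x hx => obtain ⟨g, rfl⟩ := hx; simp only [hφ g, hψ g, h1, h2]
      | zero => simp
      | add x y _ _ hx hy => simp only [map_add, hx, hy]
      | smul a x _ hx => simp only [map_smul, hx]
    intro x hx y hy hxy
    rw [← h3 x hx, ← h3 y hy, hxy]
  · unfold orbSpan
    rw [Submodule.map_span, ← Set.range_comp]
    congr 2
    funext g
    simp [hφ g, h1]

lemma noniso {u u' : VV q} {T : VV q →ₗ[ℝ] VV q} (hT : Good T)
    (H : (T u ≠ 0 ∧ ∀ f ∈ orbSpan (SG q) u', T f = 0) ∨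
      (T u' ≠ 0 ∧ ∀ f ∈ orbSpan (SG q) u, T f = 0)) :
    ¬ ∃ φ : VV q →ₗ[ℝ] VV q, IsEquivar (SG q) φ ∧
      Set.InjOn φ (orbSpan (SG q) u) ∧
      Submodule.map φ (orbSpan (SG q) u) = orbSpan (SG q) u' := by
  rintro ⟨φ, hφ, hi, hm⟩
  rcases H with ⟨h1, h2⟩ | ⟨h1, h2⟩
  · apply h1
    refine hi (hT.2 _ (orbSpan_invt u) _ (self_mem_orbSpan u)) (Submodule.zero_mem _) ?_
    rw [hT.1 φ hφ, map_zero]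
    apply h2
    rw [← hm]
    exact Submodule.mem_map_of_mem (self_mem_orbSpan u)
  · apply h1
    have := self_mem_orbSpan u'
    rw [← hm] at this
    obtain ⟨w, hw, hw'⟩ := this
    rw [← hw', ← hT.1 φ hφ, h2 w hw, map_zero]

lemma top_of_dot {W : Submodule ℝ (VV q)} (h : ∀ f : VV q, (∀ w ∈ W, f ⬝ᵥ w = 0) → f = 0) :
    W = ⊤ := by
  by_contra hW
  obtain ⟨φ, hφ0, hφ⟩ := Submodule.exists_le_ker_of_lt_top W (lt_top_iff_ne_top.2 hW)
  apply hφ0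
  have hd : ∀ w, φ w = (fun p => φ (Pi.single p 1)) ⬝ᵥ w := by
    intro w
    conv_lhs => rw [pi_eq_sum_univ' w]
    simp only [map_sum, map_smul, dotProduct, smul_eq_mul]
    refine Finset.sum_congr rfl fun p _ => ?_
    rw [mul_comm]
  have := h _ (fun w hw => (hd w).symm.trans (hφ hw))
  refine LinearMap.ext fun w => ?_
  rw [hd, this, zero_dotProduct, LinearMap.zero_apply]

lemma indep_of_dot {ι : Type*} (W : ι → Submodule ℝ (VV q))
    (h : ∀ i j, i ≠ j → ∀ f ∈ W i, ∀ f' ∈ W j, f ⬝ᵥ f' = 0) : iSupIndep W := by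
  intro i
  rw [Submodule.disjoint_def]
  intro x hx hx'
  have : ⨆ j, ⨆ (_ : j ≠ i), W j ≤
      LinearMap.ker (dotProductBilin ℝ ℝ x : VV q →ₗ[ℝ] ℝ) := by
    refine iSup₂_le fun j hj f hf => ?_
    exact h i j hj.symm x hx f hf
  exact dotProduct_self_eq_zero.1 (this hx')

/-- The equivariant maps `ℝ^q → ℝ^{q×q}`. -/
def Phi (β γ δ : ℝ) : (Fin q → ℝ) →ₗ[ℝ] VV q where
  toFun a p := β * a p.1 + γ * a p.2 + if p.1 = p.2 then δ * a p.1 else 0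
  map_add' a b := by
    funext p; simp only [Pi.add_apply]; split_ifs <;> ring
  map_smul' c a := by
    funext p; simp only [Pi.smul_apply, smul_eq_mul, RingHom.id_apply]; split_ifs <;> ring

lemma Phi_apply (β γ δ : ℝ) (a : Fin q → ℝ) (i j : Fin q) :
    Phi β γ δ a (i, j) = β * a i + γ * a j + if i = j then δ * a i else 0 := rfl

lemma act_Phi (g : SG q) (β γ δ : ℝ) (a : Fin q → ℝ) :
    actF (SG q) g (Phi β γ δ a) = Phi β γ δ (fun i => a (g⁻¹ i)) := by
  funext ⟨i, j⟩
  simp [actF_apply, Phi_apply]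

/-- Row sums. -/
def rs (f : VV q) (i : Fin q) : ℝ := ∑ k, f (i, k)
/-- Column sums. -/
def cs (f : VV q) (i : Fin q) : ℝ := ∑ k, f (k, i)
/-- Diagonal. -/
def dg (f : VV q) (i : Fin q) : ℝ := f (i, i)

lemma dot_Phi (f : VV q) (β γ δ : ℝ) (a : Fin q → ℝ) :
    f ⬝ᵥ Phi β γ δ a = ∑ i, a i * (β * rs f i + γ * cs f i + δ * dg f i) := by
  simp only [dotProduct, Fintype.sum_prod_type, Phi_apply, mul_add, Finset.sum_add_distrib,
    rs, cs, dg, Finset.mul_sum, mul_ite, mul_zero, Finset.sum_ite_eq, Finset.mem_univ, if_true]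
  congr 1
  · congr 1
    · refine Finset.sum_congr rfl fun i _ => Finset.sum_congr rfl fun j _ => ?_
      ring
    · rw [Finset.sum_comm]
      refine Finset.sum_congr rfl fun i _ => Finset.sum_congr rfl fun j _ => ?_
      ring
  · refine Finset.sum_congr rfl fun i _ => ?_
    ring

lemma rs_Phi (β γ δ : ℝ) (a : Fin q → ℝ) (i : Fin q) :
    rs (Phi β γ δ a) i = (β * q + δ) * a i + γ * ∑ k, a k := by
  simp [rs, Phi_apply, Finset.sum_add_distrib, Finset.mul_sum]
  ring

lemma cs_Phi (β γ δ : ℝ) (a : Fin q → ℝ) (i : Fin q) :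
    cs (Phi β γ δ a) i = (γ * q + δ) * a i + β * ∑ k, a k := by
  simp [cs, Phi_apply, Finset.sum_add_distrib, Finset.mul_sum]
  ring

lemma dg_Phi (β γ δ : ℝ) (a : Fin q → ℝ) (i : Fin q) :
    dg (Phi β γ δ a) i = (β + γ + δ) * a i := by
  simp [dg, Phi_apply]
  ring

lemma rs_act (g : SG q) (f : VV q) (i : Fin q) : rs (actF (SG q) g f) i = rs f (g⁻¹ i) := by
  simp only [rs, actF_apply]
  exact Equiv.sum_comp g⁻¹ (fun k => f (g⁻¹ i, k))

lemma dg_act (g : SG q) (f : VV q) (i : Fin q) : dg (actF (SG q) g f) i = dg f (g⁻¹ i) := rfl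

/-- images of sum zero vectors -/
def UZ (β γ δ : ℝ) : Submodule ℝ (VV q) where
  carrier := {f | ∃ a : Fin q → ℝ, ∑ i, a i = 0 ∧ f = Phi β γ δ a}
  zero_mem' := ⟨0, by simp⟩
  add_mem' := by
    rintro _ _ ⟨a, ha, rfl⟩ ⟨b, hb, rfl⟩
    exact ⟨a + b, by simp [Finset.sum_add_distrib, ha, hb], by simp⟩
  smul_mem' := by
    rintro c _ ⟨a, ha, rfl⟩
    exact ⟨c • a, by simp [← Finset.mul_sum, ha], by simp⟩

/-- images of constant vectors -/
def UC (β γ δ : ℝ) : Submodule ℝ (VV q) where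
  carrier := {f | ∃ t : ℝ, f = Phi β γ δ (fun _ => t)}
  zero_mem' := ⟨0, by symm; exact map_zero _⟩
  add_mem' := by
    rintro _ _ ⟨a, rfl⟩ ⟨b, rfl⟩
    exact ⟨a + b, by rw [← map_add]; rfl⟩
  smul_mem' := by
    rintro c _ ⟨a, rfl⟩
    exact ⟨c * a, by rw [← map_smul]; rfl⟩

/-- (anti)symmetric matrices with zero diagonal and row sums. -/
def US (s : ℝ) : Submodule ℝ (VV q) where
  carrier := {f | (∀ i j, f (j, i) = s * f (i, j)) ∧ (∀ i, f (i, i) = 0) ∧ ∀ i, rs f i = 0}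
  zero_mem' := ⟨by simp, by simp, by simp [rs]⟩
  add_mem' := by
    rintro a b ⟨h1, h2, h3⟩ ⟨k1, k2, k3⟩
    refine ⟨fun i j => ?_, fun i => ?_, fun i => ?_⟩
    · simp only [Pi.add_apply, h1 i j, k1 i j]; ring
    · simp only [Pi.add_apply, h2 i, k2 i]; ring
    · have := h3 i
      have := k3 i
      simp only [rs, Pi.add_apply, Finset.sum_add_distrib] at *
      linarith
  smul_mem' := by
    rintro c a ⟨h1, h2, h3⟩
    refine ⟨fun i j => ?_, fun i => ?_, fun i => ?_⟩
    · simp only [Pi.smul_apply, smul_eq_mul, h1 i j]; ring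
    · simp only [Pi.smul_apply, smul_eq_mul, h2 i]; ring
    · have := h3 i
      simp only [rs, Pi.smul_apply, smul_eq_mul, ← Finset.mul_sum] at *
      rw [this, mul_zero]

lemma UZ_invt (β γ δ : ℝ) : IsInvt (SG q) (UZ β γ δ : Submodule ℝ (VV q)) := by
  rintro g _ ⟨a, ha, rfl⟩
  exact ⟨_, (Equiv.sum_comp g⁻¹ a).trans ha, act_Phi g β γ δ a⟩

lemma UC_invt (β γ δ : ℝ) : IsInvt (SG q) (UC β γ δ : Submodule ℝ (VV q)) := by
  rintro g _ ⟨a, rfl⟩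
  exact ⟨a, act_Phi g β γ δ _⟩

lemma US_invt (s : ℝ) : IsInvt (SG q) (US s : Submodule ℝ (VV q)) := by
  rintro g f ⟨h1, h2, h3⟩
  exact ⟨fun i j => h1 _ _, fun i => h2 _, fun i => by rw [rs_act]; exact h3 _⟩

lemma US_cs {s : ℝ} {f : VV q} (h : f ∈ US s) (i : Fin q) : cs f i = 0 := by
  obtain ⟨h1, h2, h3⟩ := h
  have : cs f i = s * rs f i := by
    simp only [cs, rs, Finset.mul_sum]
    exact Finset.sum_congr rfl fun k _ => h1 _ _
  rw [this, h3, mul_zero]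

/-- Linear map given by combos of row sums and diagonal. -/
def Psi (r d : ℝ) : VV q →ₗ[ℝ] (Fin q → ℝ) where
  toFun f i := r * rs f i + d * dg f i
  map_add' a b := by
    funext i; simp only [rs, dg, Pi.add_apply, Finset.sum_add_distrib]; ring
  map_smul' c a := by
    funext i
    simp only [rs, dg, Pi.smul_apply, smul_eq_mul, ← Finset.mul_sum, RingHom.id_apply]; ring

lemma Psi_apply (r d : ℝ) (f : VV q) (i : Fin q) : Psi r d f i = r * rs f i + d * dg f i := rfl

lemma equivar_PhiPsi (r d β γ δ : ℝ) :
    IsEquivar (SG q) ((Phi β γ δ).comp (Psi r d) : VV q →ₗ[ℝ] VV q) := by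
  intro g f
  simp only [LinearMap.comp_apply, act_Phi]
  congr 1
  funext i
  simp [Psi_apply, rs_act, dg_act]

/-- matrix units -/
def ee (x y : Fin q) : VV q := fun p => if p.1 = x ∧ p.2 = y then 1 else 0

lemma ee_apply (x y i j : Fin q) : ee x y (i, j) = if i = x ∧ j = y then 1 else 0 := rfl

lemma act_ee (g : SG q) (x y : Fin q) : actF (SG q) g (ee x y) = ee (g x) (g y) := by
  funext ⟨i, j⟩
  simp only [actF_apply, ee_apply, Equiv.Perm.inv_eq_iff_eq]

lemma dot_ee (f : VV q) (x y : Fin q) : f ⬝ᵥ ee x y = f (x, y) := by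
  have : ee x y = Pi.single (x, y) 1 := by
    funext ⟨i, j⟩
    simp [ee_apply, Pi.single_apply]
  rw [this]
  simp

/-- `e_x - e_y` -/
def dd (x y : Fin q) : Fin q → ℝ := fun i => (if i = x then 1 else 0) - (if i = y then 1 else 0)

lemma dd_sum (x y : Fin q) : ∑ i, dd x y i = 0 := by
  simp [dd]

lemma dd_act (g : SG q) (x y : Fin q) : (fun i => dd x y (g⁻¹ i)) = dd (g x) (g y) := by
  funext i
  simp only [dd, Equiv.Perm.inv_eq_iff_eq]

/-- the third vector -/
def v3 (a b c : Fin q) : VV q := ee a b + ee b c + ee c a - ee b a - ee c b - ee a c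

/-- the fourth vector -/
def v4 (a b c d : Fin q) : VV q :=
  ee a c - ee c b + ee b d - ee d a + ee c a - ee b c + ee d b - ee a d

/-- first symmetrizer -/
def T1 (a b : Fin q) : VV q →ₗ[ℝ] VV q := 1 - actL (Equiv.swap a b)
/-- third symmetrizer -/
def T3 (a b c : Fin q) : VV q →ₗ[ℝ] VV q :=
  1 + actL (Equiv.swap a b * Equiv.swap b c) + actL (Equiv.swap b c * Equiv.swap a b)
    - actL (Equiv.swap a b) - actL (Equiv.swap b c) - actL (Equiv.swap a c)
/-- fourth symmetrizer -/
def T4 (a b c d : Fin q) : VV q →ₗ[ℝ] VV q :=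
  1 - actL (Equiv.swap a b) - actL (Equiv.swap c d) + actL (Equiv.swap a b * Equiv.swap c d)

lemma T1_good (a b : Fin q) : Good (T1 a b) := Good.one.sub (Good.act _)
lemma T3_good (a b c : Fin q) : Good (T3 a b c) :=
  ((((Good.one.add (Good.act _)).add (Good.act _)).sub (Good.act _)).sub (Good.act _)).sub
    (Good.act _)
lemma T4_good (a b c d : Fin q) : Good (T4 a b c d) :=
  ((Good.one.sub (Good.act _)).sub (Good.act _)).add (Good.act _)

lemma T1_sa (a b : Fin q) (f h : VV q) : T1 a b f ⬝ᵥ h = f ⬝ᵥ T1 a b h := by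
  simp [T1, actL_apply, sub_dotProduct, dotProduct_sub, dot_act]

lemma T3_sa (a b c : Fin q) (f h : VV q) : T3 a b c f ⬝ᵥ h = f ⬝ᵥ T3 a b c h := by
  simp only [T3, actL_apply, sub_dotProduct, dotProduct_sub, add_dotProduct, dotProduct_add,
    dot_act, LinearMap.sub_apply, LinearMap.add_apply, Module.End.one_apply, mul_inv_rev,
    Equiv.swap_inv]
  ring

lemma T4_sa {a b c d : Fin q} (hac : a ≠ c) (had : a ≠ d) (hbc : b ≠ c)
    (hbd : b ≠ d) (f h : VV q) : T4 a b c d f ⬝ᵥ h = f ⬝ᵥ T4 a b c d h := by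
  have hc : Equiv.swap c d * Equiv.swap a b = Equiv.swap a b * Equiv.swap c d := by
    ext i
    simp only [Equiv.Perm.mul_apply, Equiv.swap_apply_def]
    grind
  simp only [T4, actL_apply, sub_dotProduct, dotProduct_sub, add_dotProduct, dotProduct_add,
    dot_act, LinearMap.sub_apply, LinearMap.add_apply, Module.End.one_apply, mul_inv_rev,
    Equiv.swap_inv, hc]

lemma T1_Phi {a b : Fin q} (β γ δ : ℝ) (x : Fin q → ℝ) :
    T1 a b (Phi β γ δ x) = (x a - x b) • Phi β γ δ (dd a b) := by
  simp only [T1, actL_apply, LinearMap.sub_apply, Module.End.one_apply, act_Phi]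
  rw [← map_sub, ← map_smul]
  congr 1
  funext i
  simp only [Pi.sub_apply, Pi.smul_apply, dd, Equiv.swap_inv, Equiv.swap_apply_def, smul_eq_mul]
  split_ifs <;> simp_all

lemma T3_apply {a b c : Fin q} (hab : a ≠ b) (hac : a ≠ c) (hbc : b ≠ c) (f : VV q) :
    T3 a b c f = (f (a, b) + f (b, c) + f (c, a) - f (b, a) - f (c, b) - f (a, c)) • v3 a b c := by
  funext ⟨i, j⟩
  simp only [T3, actL_apply, LinearMap.sub_apply, LinearMap.add_apply, Module.End.one_apply,
    Pi.sub_apply, Pi.add_apply, Pi.smul_apply, actF_apply, v3, ee_apply, smul_eq_mul,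
    mul_inv_rev, Equiv.swap_inv, Equiv.Perm.mul_apply]
  have key : ∀ i : Fin q, i = a ∨ i = b ∨ i = c ∨ (i ≠ a ∧ i ≠ b ∧ i ≠ c) := by
    intro i; tauto
  rcases key i with rfl | rfl | rfl | ⟨h1, h2, h3⟩ <;>
  rcases key j with rfl | rfl | rfl | ⟨k1, k2, k3⟩ <;>
  simp [*, Equiv.swap_apply_def, Ne.symm hab, Ne.symm hac, Ne.symm hbc] <;> ring

lemma T4_apply {a b c d : Fin q} (hab : a ≠ b) (hac : a ≠ c) (had : a ≠ d) (hbc : b ≠ c)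
    (hbd : b ≠ d) (hcd : c ≠ d) (f : VV q) (hf : ∀ i j, f (j, i) = f (i, j)) :
    T4 a b c d f = (f (a, c) - f (b, c) - f (a, d) + f (b, d)) • v4 a b c d := by
  funext ⟨i, j⟩
  simp only [T4, actL_apply, LinearMap.sub_apply, LinearMap.add_apply, Module.End.one_apply,
    Pi.sub_apply, Pi.add_apply, Pi.smul_apply, actF_apply, v4, ee_apply, smul_eq_mul,
    mul_inv_rev, Equiv.swap_inv, Equiv.Perm.mul_apply]
  have key : ∀ i : Fin q, i = a ∨ i = b ∨ i = c ∨ i = d ∨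
      (i ≠ a ∧ i ≠ b ∧ i ≠ c ∧ i ≠ d) := by
    intro i; tauto
  have e1 := hf a b
  have e2 := hf a c
  have e3 := hf a d
  have e4 := hf b c
  have e5 := hf b d
  have e6 := hf c d
  clear hf
  rcases key i with rfl | rfl | rfl | rfl | ⟨h1, h2, h3, h4⟩ <;>
  rcases key j with rfl | rfl | rfl | rfl | ⟨k1, k2, k3, k4⟩ <;>
  simp [Equiv.swap_apply_def, Ne.symm hab, Ne.symm hac, Ne.symm hbc, Ne.symm had, Ne.symm hbd,
    Ne.symm hcd, *] <;> ring

lemma T3_Phi {a b c : Fin q} (hab : a ≠ b) (hac : a ≠ c) (hbc : b ≠ c) (β γ δ : ℝ)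
    (x : Fin q → ℝ) : T3 a b c (Phi β γ δ x) = 0 := by
  rw [T3_apply hab hac hbc]
  have : Phi β γ δ x (a, b) + Phi β γ δ x (b, c) + Phi β γ δ x (c, a) - Phi β γ δ x (b, a)
      - Phi β γ δ x (c, b) - Phi β γ δ x (a, c) = 0 := by
    simp only [Phi_apply, hab, hac, hbc, hab.symm, hac.symm, hbc.symm, if_false]
    ring
  rw [this, zero_smul]

lemma T4_Phi {a b c d : Fin q} (hac : a ≠ c) (had : a ≠ d) (hbc : b ≠ c)
    (hbd : b ≠ d) (β γ δ : ℝ)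
    (x : Fin q → ℝ) : T4 a b c d (Phi β γ δ x) = 0 := by
  simp only [T4, actL_apply, LinearMap.sub_apply, LinearMap.add_apply, Module.End.one_apply,
    act_Phi]
  rw [← map_sub, ← map_sub, ← map_add, ← map_zero (Phi β γ δ)]
  congr 1
  funext i
  simp only [Pi.sub_apply, Pi.add_apply, Pi.zero_apply, Equiv.swap_inv, mul_inv_rev,
    Equiv.Perm.mul_apply, Equiv.swap_apply_def]
  grind

lemma v3_mem {a b c : Fin q} (hab : a ≠ b) (hac : a ≠ c) (hbc : b ≠ c) :
    v3 a b c ∈ US (-1) := by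
  refine ⟨fun i j => ?_, fun i => ?_, fun i => ?_⟩
  · simp only [v3, Pi.add_apply, Pi.sub_apply, ee_apply, and_comm]
    ring
  · simp only [v3, Pi.add_apply, Pi.sub_apply, ee_apply]
    grind
  · simp [rs, v3, ee_apply, Finset.sum_add_distrib, Finset.sum_sub_distrib, ite_and]
    ring

lemma v4_mem {a b c d : Fin q} (hac : a ≠ c) (had : a ≠ d) (hbc : b ≠ c)
    (hbd : b ≠ d) : v4 a b c d ∈ US 1 := by
  refine ⟨fun i j => ?_, fun i => ?_, fun i => ?_⟩
  · simp only [v4, Pi.add_apply, Pi.sub_apply, ee_apply, and_comm]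
    ring
  · simp only [v4, Pi.add_apply, Pi.sub_apply, ee_apply]
    grind
  · simp [rs, v4, ee_apply, Finset.sum_add_distrib, Finset.sum_sub_distrib, ite_and]
    ring

lemma T3_v3 {a b c : Fin q} (hab : a ≠ b) (hac : a ≠ c) (hbc : b ≠ c) :
    T3 a b c (v3 a b c) = (6 : ℝ) • v3 a b c := by
  rw [T3_apply hab hac hbc]
  congr 1
  simp [v3, ee_apply, hab, hac, hbc, hab.symm, hac.symm, hbc.symm]
  norm_num

lemma T4_v4 {a b c d : Fin q} (hab : a ≠ b) (hac : a ≠ c) (had : a ≠ d) (hbc : b ≠ c)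
    (hbd : b ≠ d) (hcd : c ≠ d) :
    T4 a b c d (v4 a b c d) = (4 : ℝ) • v4 a b c d := by
  rw [T4_apply hab hac had hbc hbd hcd]
  · congr 1
    simp [v4, ee_apply, hab, hac, hbc, hab.symm, hac.symm, hbc.symm, had, had.symm, hbd, hbd.symm,
      hcd, hcd.symm]
    norm_num
  · intro i j
    simpa using (v4_mem hac had hbc hbd).1 i j

lemma T1_v3 {a b c : Fin q} (hac : a ≠ c) (hbc : b ≠ c) :
    T1 a b (v3 a b c) = (2 : ℝ) • v3 a b c := by
  simp only [T1, actL_apply, LinearMap.sub_apply, Module.End.one_apply]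
  have : actF (SG q) (Equiv.swap a b) (v3 a b c) = - v3 a b c := by
    rw [← actL_apply]
    simp only [v3, map_add, map_sub, actL_apply, act_ee, Equiv.swap_apply_left,
      Equiv.swap_apply_right, Equiv.swap_apply_of_ne_of_ne hac.symm hbc.symm]
    abel
  rw [this, two_smul, sub_neg_eq_add]

lemma T1_v4 {a b c d : Fin q} (hac : a ≠ c) (had : a ≠ d) (hbc : b ≠ c)
    (hbd : b ≠ d) :
    T1 a b (v4 a b c d) = (2 : ℝ) • v4 a b c d := by
  simp only [T1, actL_apply, LinearMap.sub_apply, Module.End.one_apply]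
  have : actF (SG q) (Equiv.swap a b) (v4 a b c d) = - v4 a b c d := by
    rw [← actL_apply]
    simp only [v4, map_add, map_sub, actL_apply, act_ee, Equiv.swap_apply_left,
      Equiv.swap_apply_right, Equiv.swap_apply_of_ne_of_ne hac.symm hbc.symm,
      Equiv.swap_apply_of_ne_of_ne had.symm hbd.symm]
    abel
  rw [this, two_smul, sub_neg_eq_add]

lemma dot_sym_anti {f h : VV q} (hf : f ∈ US (-1)) (hh : h ∈ US 1) : f ⬝ᵥ h = 0 := by
  have : f ⬝ᵥ h = - (f ⬝ᵥ h) := by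
    conv_lhs => simp only [dotProduct, Fintype.sum_prod_type]
    rw [Finset.sum_comm]
    simp only [dotProduct, Fintype.sum_prod_type, ← Finset.sum_neg_distrib]
    refine Finset.sum_congr rfl fun i _ => Finset.sum_congr rfl fun j _ => ?_
    rw [hf.1 i j, hh.1 i j]
    ring
  linarith

/-- orthogonality of subspaces -/
def Orth (W W' : Submodule ℝ (VV q)) : Prop := ∀ f ∈ W, ∀ f' ∈ W', f ⬝ᵥ f' = 0

lemma Orth.symm {W W' : Submodule ℝ (VV q)} (h : Orth W W') : Orth W' W :=
  fun f hf f' hf' => by rw [dotProduct_comm]; exact h f' hf' f hf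

lemma Orth.mono {W W' U U' : Submodule ℝ (VV q)} (h : Orth U U') (h1 : W ≤ U) (h2 : W' ≤ U') :
    Orth W W' := fun f hf f' hf' => h f (h1 hf) f' (h2 hf')

lemma orth_CZ (β γ δ β' γ' δ' : ℝ) :
    Orth (UC β γ δ : Submodule ℝ (VV q)) (UZ β' γ' δ') := by
  rintro _ ⟨t, rfl⟩ _ ⟨a, ha, rfl⟩
  rw [dot_Phi]
  simp only [rs_Phi, cs_Phi, dg_Phi]
  rw [← Finset.sum_mul, ha, zero_mul]

lemma orth_CC : Orth (UC 0 0 1 : Submodule ℝ (VV q)) (UC (1/2) (1/2) (-1)) := by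
  rintro _ ⟨t, rfl⟩ _ ⟨s, rfl⟩
  rw [dot_Phi]
  simp only [rs_Phi, cs_Phi, dg_Phi]
  refine Finset.sum_eq_zero fun i _ => ?_
  ring

lemma orth_ZZ {β γ δ β' γ' δ' : ℝ}
    (h : β' * (β * q + δ) + γ' * (γ * q + δ) + δ' * (β + γ + δ) = 0) :
    Orth (UZ β γ δ : Submodule ℝ (VV q)) (UZ β' γ' δ') := by
  rintro _ ⟨b, hb, rfl⟩ _ ⟨a, ha, rfl⟩
  rw [dot_Phi]
  simp only [rs_Phi, cs_Phi, dg_Phi, hb]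
  refine Finset.sum_eq_zero fun i _ => ?_
  linear_combination (a i * b i) * h

lemma orth_SZ (s β' γ' δ' : ℝ) :
    Orth (US s : Submodule ℝ (VV q)) (UZ β' γ' δ') := by
  rintro f hf _ ⟨a, ha, rfl⟩
  rw [dot_Phi]
  refine Finset.sum_eq_zero fun i _ => ?_
  rw [US_cs hf i, hf.2.2 i, dg, hf.2.1 i]
  ring

lemma orth_SC (s β' γ' δ' : ℝ) :
    Orth (US s : Submodule ℝ (VV q)) (UC β' γ' δ') := by
  rintro f hf _ ⟨a, rfl⟩
  rw [dot_Phi]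
  refine Finset.sum_eq_zero fun i _ => ?_
  rw [US_cs hf i, hf.2.2 i, dg, hf.2.1 i]
  ring

lemma orth_SS : Orth (US (-1) : Submodule ℝ (VV q)) (US 1) :=
  fun _ hf _ hh => dot_sym_anti hf hh

lemma forall_idx {P : (i : Fin 4) → Fin (![2, 3, 1, 1] i) → Prop}
    (h00 : P 0 (0 : Fin 2)) (h01 : P 0 (1 : Fin 2)) (h10 : P 1 (0 : Fin 3))
    (h11 : P 1 (1 : Fin 3)) (h12 : P 1 (2 : Fin 3)) (h20 : P 2 (0 : Fin 1))
    (h30 : P 3 (0 : Fin 1)) : ∀ i j, P i j := by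
  intro i
  fin_cases i
  · intro j
    change Fin 2 at j
    fin_cases j
    exacts [h00, h01]
  · intro j
    change Fin 3 at j
    fin_cases j
    exacts [h10, h11, h12]
  · intro j
    change Fin 1 at j
    fin_cases j
    exact h20
  · intro j
    change Fin 1 at j
    fin_cases j
    exact h30

lemma exists_perm {n : ℕ} {x y : Fin n → Fin q} (hx : Function.Injective x)
    (hy : Function.Injective y) : ∃ g : SG q, ∀ k, g (x k) = y k := by
  obtain ⟨g, hg⟩ := (Equiv.Perm.isMultiplyPretransitive (Fin q) n).exists_smul_eq ⟨x, hx⟩ ⟨y, hy⟩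
  exact ⟨g, fun k => by simpa using DFunLike.congr_fun hg k⟩

lemma exists_perm2 {a b i j : Fin q} (hab : a ≠ b) (hij : i ≠ j) :
    ∃ g : SG q, g a = i ∧ g b = j := by
  obtain ⟨g, hg⟩ := exists_perm (x := ![a, b]) (y := ![i, j])
    (by intro k l; fin_cases k <;> fin_cases l <;> simp [*, Ne.symm hab])
    (by intro k l; fin_cases k <;> fin_cases l <;> simp [*, Ne.symm hij])
  exact ⟨g, hg 0, hg 1⟩

lemma exists_perm3 {a b c i j k : Fin q} (hab : a ≠ b) (hac : a ≠ c) (hbc : b ≠ c)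
    (hij : i ≠ j) (hik : i ≠ k) (hjk : j ≠ k) :
    ∃ g : SG q, g a = i ∧ g b = j ∧ g c = k := by
  obtain ⟨g, hg⟩ := exists_perm (x := ![a, b, c]) (y := ![i, j, k])
    (by intro m l; fin_cases m <;> fin_cases l <;> simp [*, Ne.symm hab, Ne.symm hac, Ne.symm hbc])
    (by intro m l; fin_cases m <;> fin_cases l <;> simp [*, Ne.symm hij, Ne.symm hik, Ne.symm hjk])
  exact ⟨g, hg 0, hg 1, hg 2⟩

lemma exists_perm4 {a b c d i j k l : Fin q} (hab : a ≠ b) (hac : a ≠ c) (had : a ≠ d)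
    (hbc : b ≠ c) (hbd : b ≠ d) (hcd : c ≠ d)
    (hij : i ≠ j) (hik : i ≠ k) (hil : i ≠ l) (hjk : j ≠ k) (hjl : j ≠ l) (hkl : k ≠ l) :
    ∃ g : SG q, g a = i ∧ g b = j ∧ g c = k ∧ g d = l := by
  obtain ⟨g, hg⟩ := exists_perm (x := ![a, b, c, d]) (y := ![i, j, k, l])
    (by intro m l; fin_cases m <;> fin_cases l <;>
          simp [*, Ne.symm hab, Ne.symm hac, Ne.symm hbc, Ne.symm had, Ne.symm hbd, Ne.symm hcd])
    (by intro m n; fin_cases m <;> fin_cases n <;>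
          simp [*, Ne.symm hij, Ne.symm hik, Ne.symm hjk, Ne.symm hil, Ne.symm hjl, Ne.symm hkl])
  exact ⟨g, hg 0, hg 1, hg 2, hg 3⟩

lemma sum_dd (x y : Fin q) (F : Fin q → ℝ) : ∑ i, dd x y i * F i = F x - F y := by
  simp [dd, sub_mul, Finset.sum_sub_distrib]

lemma const_of {a b : Fin q} (hab : a ≠ b) {f : VV q} {β γ δ : ℝ}
    (h : ∀ g : SG q, f ⬝ᵥ actF (SG q) g (Phi β γ δ (dd a b)) = 0) (i j : Fin q) :
    β * rs f i + γ * cs f i + δ * dg f i = β * rs f j + γ * cs f j + δ * dg f j := by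
  by_cases hij : i = j
  · rw [hij]
  obtain ⟨g, rfl, rfl⟩ := exists_perm2 hab hij
  have := h g
  rw [act_Phi, dd_act, dot_Phi, sum_dd] at this
  linarith

lemma final_zero {a b c d : Fin q} (hq : 4 ≤ q) (hab : a ≠ b) (hac : a ≠ c) (had : a ≠ d)
    (hbc : b ≠ c) (hbd : b ≠ d) (hcd : c ≠ d) (f : VV q)
    (h00 : ∀ g : SG q, f ⬝ᵥ actF (SG q) g (Phi 0 0 1 (fun _ => 1)) = 0)
    (h01 : ∀ g : SG q, f ⬝ᵥ actF (SG q) g (Phi (1/2) (1/2) (-1) (fun _ => 1)) = 0)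
    (h10 : ∀ g : SG q, f ⬝ᵥ actF (SG q) g (Phi 0 0 1 (dd a b)) = 0)
    (h11 : ∀ g : SG q, f ⬝ᵥ actF (SG q) g (Phi 1 (-1) 0 (dd a b)) = 0)
    (h12 : ∀ g : SG q, f ⬝ᵥ actF (SG q) g (Phi 1 1 (-2) (dd a b)) = 0)
    (h20 : ∀ g : SG q, f ⬝ᵥ actF (SG q) g (v3 a b c) = 0)
    (h30 : ∀ g : SG q, f ⬝ᵥ actF (SG q) g (v4 a b c d) = 0) : f = 0 := by
  have hq' : (4 : ℝ) ≤ q := by exact_mod_cast hq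
  have e0 : ∑ i, dg f i = 0 := by
    have := h00 1
    rw [actF_one, dot_Phi] at this
    simpa using this
  have hdg : ∀ i, dg f i = 0 := by
    intro i
    have : ∑ j : Fin q, dg f j = ∑ j : Fin q, dg f i := by
      refine Finset.sum_congr rfl fun j _ => ?_
      have := const_of hab h10 i j
      linarith
    rw [e0] at this
    simp at this
    rcases this with h | h
    · subst h; exact i.elim0
    · exact h
  have e1 : ∑ i, (rs f i + cs f i) = 0 := by
    have := h01 1
    rw [actF_one, dot_Phi] at this
    simp only [hdg, one_mul, mul_zero, add_zero, ← mul_add, ← Finset.mul_sum] at this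
    linarith
  have hr' : ∀ i j, rs f i = rs f j ∧ cs f i = cs f j := by
    intro i j
    have h1 := const_of hab h11 i j
    have h2 := const_of hab h12 i j
    simp only [hdg] at h1 h2
    constructor <;> linarith
  have e2 : ∑ i, rs f i = ∑ i, cs f i := by
    simp only [rs, cs]
    exact Finset.sum_comm
  rw [Finset.sum_add_distrib] at e1
  have hr : ∀ i, rs f i = 0 := by
    intro i
    have h1 : ∑ j : Fin q, rs f j = ∑ j : Fin q, rs f i :=
      Finset.sum_congr rfl fun j _ => (hr' j i).1
    rw [show ∑ j : Fin q, rs f j = 0 by linarith] at h1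
    simp at h1
    rcases h1 with h | h
    · subst h; exact i.elim0
    · exact h
  have hc : ∀ i, cs f i = 0 := by
    intro i
    have h1 : ∑ j : Fin q, cs f j = ∑ j : Fin q, cs f i :=
      Finset.sum_congr rfl fun j _ => (hr' j i).2
    rw [show ∑ j : Fin q, cs f j = 0 by linarith] at h1
    simp at h1
    rcases h1 with h | h
    · subst h; exact i.elim0
    · exact h
  have hsym : ∀ i j, f (i, j) = f (j, i) := by
    have t : ∀ i j k, (f (i, j) - f (j, i)) + (f (j, k) - f (k, j)) + (f (k, i) - f (i, k)) = 0 := by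
      intro i j k
      by_cases hij : i = j
      · subst hij; ring
      by_cases hik : i = k
      · subst hik; ring
      by_cases hjk : j = k
      · subst hjk; ring
      obtain ⟨g, rfl, rfl, rfl⟩ := exists_perm3 hab hac hbc hij hik hjk
      have := h20 g
      rw [← actL_apply] at this
      simp only [v3, map_add, map_sub, actL_apply, act_ee, dotProduct_add, dotProduct_sub,
        dot_ee] at this
      linarith
    intro i j
    have h1 : ∑ k : Fin q, ((f (i, j) - f (j, i)) + (f (j, k) - f (k, j)) + (f (k, i) - f (i, k)))
        = 0 := Finset.sum_eq_zero fun k _ => t i j k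
    have r1 := hr i
    have r2 := hr j
    have c1 := hc i
    have c2 := hc j
    simp only [rs, cs] at r1 r2 c1 c2
    simp only [Finset.sum_add_distrib, Finset.sum_sub_distrib, r1, r2, c1, c2] at h1
    simp only [Finset.sum_const, Finset.card_univ, Fintype.card_fin, nsmul_eq_mul] at h1
    have h2 : (q : ℝ) * (f (i, j) - f (j, i)) = 0 := by linarith
    rcases mul_eq_zero.1 h2 with h | h
    · linarith
    · linarith
  have hd' : ∀ i, f (i, i) = 0 := hdg
  have t4 : ∀ i j k l, i ≠ j → i ≠ k → i ≠ l → j ≠ k → j ≠ l →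
      f (i, k) - f (j, k) = f (i, l) - f (j, l) := by
    intro i j k l hij hik hil hjk hjl
    by_cases hkl : k = l
    · subst hkl; ring
    obtain ⟨g, rfl, rfl, rfl, rfl⟩ :=
      exists_perm4 hab hac had hbc hbd hcd hij hik hil hjk hjl hkl
    have := h30 g
    rw [← actL_apply] at this
    simp only [v4, map_add, map_sub, actL_apply, act_ee, dotProduct_add, dotProduct_sub,
      dot_ee] at this
    have s1 := hsym (g a) (g c)
    have s2 := hsym (g b) (g c)
    have s3 := hsym (g a) (g d)
    have s4 := hsym (g b) (g d)
    linarith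
  have t3 : ∀ i j k, i ≠ j → i ≠ k → j ≠ k → f (i, k) = f (j, k) := by
    intro i j k hij hik hjk
    have h1 : ∑ l : Fin q, (f (i, l) - f (j, l)) = ∑ l : Fin q,
        ((f (i, k) - f (j, k)) - (if l = i then (f (i, k) - f (j, k)) + f (j, i) else 0)
          - (if l = j then (f (i, k) - f (j, k)) - f (i, j) else 0)) := by
      refine Finset.sum_congr rfl fun l _ => ?_
      by_cases hli : l = i
      · subst hli
        simp [hij, hd']
      by_cases hlj : l = j
      · subst hlj
        simp [hli, hd']
      simp only [hli, hlj, if_false]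
      rw [t4 i j k l hij hik (Ne.symm hli) hjk (Ne.symm hlj)]
      ring
    have r1 := hr i
    have r2 := hr j
    simp only [rs] at r1 r2
    simp only [Finset.sum_sub_distrib, r1, r2] at h1
    simp only [Finset.sum_const, Finset.card_univ, Fintype.card_fin, nsmul_eq_mul,
      Finset.sum_ite_eq', Finset.mem_univ, if_true] at h1
    have h2 : ((q : ℝ) - 2) * (f (i, k) - f (j, k)) = 0 := by
      have := hsym i j
      linarith
    rcases mul_eq_zero.1 h2 with h | h
    · linarith
    · linarith
  funext ⟨i, k⟩
  by_cases hik : i = k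
  · subst hik; exact hd' i
  have h1 : ∑ j : Fin q, f (j, k) = ∑ j : Fin q, (f (i, k) - if j = k then f (i, k) else 0) := by
    refine Finset.sum_congr rfl fun j _ => ?_
    by_cases hjk : j = k
    · subst hjk; simp [hd']
    by_cases hij : i = j
    · subst hij; simp [hjk]
    simp only [hjk, if_false]
    rw [t3 i j k hij hik hjk]
    ring
  have c1 := hc k
  simp only [cs] at c1
  rw [c1] at h1
  simp only [Finset.sum_sub_distrib, Finset.sum_const, Finset.card_univ, Fintype.card_fin,
    nsmul_eq_mul, Finset.sum_ite_eq', Finset.mem_univ, if_true] at h1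
  have h2 : ((q : ℝ) - 1) * f (i, k) = 0 := by linarith
  rcases mul_eq_zero.1 h2 with h | h
  · linarith
  · simpa using h

lemma irr_C (β γ δ : ℝ) (p : Submodule ℝ (VV q)) (hp : IsInvt (SG q) p)
    (hle : p ≤ orbSpan (SG q) (Phi β γ δ (fun _ => 1) : VV q)) :
    p = ⊥ ∨ p = orbSpan (SG q) (Phi β γ δ (fun _ => 1) : VV q) := by
  refine irr (T := 1) Good.one one_ne_zero (by simp) ?_ (fun _ _ => rfl) p hp hle
  intro f hf
  obtain ⟨t, rfl⟩ := orbSpan_le (UC_invt β γ δ) ⟨1, rfl⟩ hf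
  refine ⟨t, ?_⟩
  rw [← map_smul, Module.End.one_apply]
  congr 1
  funext i
  simp

lemma T1_dd {a b : Fin q} (hab : a ≠ b) (β γ δ : ℝ) :
    T1 a b (Phi β γ δ (dd a b)) = (2 : ℝ) • Phi β γ δ (dd a b) := by
  rw [T1_Phi]
  congr 1
  simp [dd, hab, hab.symm]
  norm_num

lemma irr_Z {a b : Fin q} (hab : a ≠ b) (β γ δ : ℝ) (p : Submodule ℝ (VV q))
    (hp : IsInvt (SG q) p)
    (hle : p ≤ orbSpan (SG q) (Phi β γ δ (dd a b))) :
    p = ⊥ ∨ p = orbSpan (SG q) (Phi β γ δ (dd a b)) := by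
  refine irr (T1_good a b) two_ne_zero (T1_dd hab β γ δ) ?_ (T1_sa a b) p hp hle
  intro f hf
  obtain ⟨t, -, rfl⟩ := orbSpan_le (UZ_invt β γ δ) ⟨_, dd_sum a b, rfl⟩ hf
  exact ⟨_, T1_Phi β γ δ t⟩

lemma Psi_Phi {r e β γ δ : ℝ} (h : r * (β * q + δ) + e * (β + γ + δ) = 1) (x : Fin q → ℝ)
    (hx : r * γ * ∑ i, x i = 0) :
    Psi r e (Phi β γ δ x) = x := by
  funext i
  rw [Psi_apply, rs_Phi, dg_Phi]
  linear_combination x i * h + hx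

lemma Psi_Phi_one {r e β γ δ : ℝ} (h : r * (β * q + δ + γ * q) + e * (β + γ + δ) = 1) :
    Psi r e (Phi β γ δ (fun _ => 1)) = (fun _ : Fin q => (1 : ℝ)) := by
  funext i
  rw [Psi_apply, rs_Phi, dg_Phi]
  simp
  linear_combination h

lemma iso_of {x : Fin q → ℝ} {β γ δ β' γ' δ' : ℝ}
    (h : ∃ r e, Psi r e (Phi β γ δ x) = x)
    (h' : ∃ r e, Psi r e (Phi β' γ' δ' x) = x) :
    ∃ φ : VV q →ₗ[ℝ] VV q, IsEquivar (SG q) φ ∧ φ (Phi β γ δ x) = (Phi β' γ' δ' x) ∧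
    Set.InjOn φ (orbSpan (SG q) (Phi β γ δ x)) ∧
    Submodule.map φ (orbSpan (SG q) (Phi β γ δ x)) = orbSpan (SG q) (Phi β' γ' δ' x) := by
  obtain ⟨r, e, h⟩ := h
  obtain ⟨r', e', h'⟩ := h'
  exact iso_aux (equivar_PhiPsi r e β' γ' δ') (equivar_PhiPsi r' e' β γ δ)
    (by simp [h]) (by simp [h'])

lemma ne_zero_of {x : Fin q → ℝ} (hx : x ≠ 0) {β γ δ : ℝ}
    (h : ∃ r e, Psi r e (Phi β γ δ x) = x) : Phi β γ δ x ≠ 0 := by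
  obtain ⟨r, e, h⟩ := h
  intro h0
  rw [h0, map_zero] at h
  exact hx h.symm

end Helpers

section Eqs

lemma u00 (q : ℕ) : uCols q 0 (0 : Fin 2) = Phi 0 0 1 (fun _ => 1) := by
  funext ⟨i, j⟩
  simp [uCols, Phi_apply]

lemma u01 (q : ℕ) : uCols q 0 (1 : Fin 2) = Phi (1/2) (1/2) (-1) (fun _ => 1) := by
  funext ⟨i, j⟩
  simp [uCols, Phi_apply]
  split_ifs <;> norm_num

lemma Ecol_eq {q : ℕ} (m n : ℕ) (hm : m < q) (hn : n < q) :
    Ecol q m n = ee ⟨m, hm⟩ ⟨n, hn⟩ := by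
  funext ⟨i, j⟩
  simp [Ecol, ee_apply, Fin.ext_iff]

lemma Ncol_eq {q : ℕ} (h0 : 0 < q) (h1 : 1 < q) (p : Fin q × Fin q) :
    Ncol q p = dd ⟨0, h0⟩ ⟨1, h1⟩ p.1 := by
  simp only [Ncol, dd, Fin.ext_iff]
  split_ifs <;> simp_all

lemma ee_sub {q : ℕ} (x y i j : Fin q) : ee x x (i, j) - ee y y (i, j) =
    if i = j then dd x y i else 0 := by
  simp only [ee_apply, dd]
  by_cases hij : i = j
  · subst hij
    simp
  · rw [if_neg hij, if_neg (by rintro ⟨rfl, rfl⟩; exact hij rfl),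
      if_neg (by rintro ⟨rfl, rfl⟩; exact hij rfl), sub_zero]

lemma u10 {q : ℕ} (h0 : 0 < q) (h1 : 1 < q) :
    uCols q 1 (0 : Fin 3) = Phi 0 0 1 (dd ⟨0, h0⟩ ⟨1, h1⟩) := by
  funext ⟨i, j⟩
  change Ecol q 0 0 (i, j) - Ecol q 1 1 (i, j) = _
  rw [Ecol_eq 0 0 h0 h0, Ecol_eq 1 1 h1 h1, ee_sub, Phi_apply]
  simp

lemma u11 {q : ℕ} (h0 : 0 < q) (h1 : 1 < q) :
    uCols q 1 (1 : Fin 3) = Phi 1 (-1) 0 (dd ⟨0, h0⟩ ⟨1, h1⟩) := by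
  funext ⟨i, j⟩
  change Ncol q (i, j) - Ncol q (j, i) = _
  rw [Ncol_eq h0 h1, Ncol_eq h0 h1, Phi_apply]
  simp
  ring

lemma u12 {q : ℕ} (h0 : 0 < q) (h1 : 1 < q) :
    uCols q 1 (2 : Fin 3) = Phi 1 1 (-2) (dd ⟨0, h0⟩ ⟨1, h1⟩) := by
  funext ⟨i, j⟩
  change Ncol q (i, j) + Ncol q (j, i) - 2 • (Ecol q 0 0 (i, j) - Ecol q 1 1 (i, j)) = _
  rw [Ncol_eq h0 h1, Ncol_eq h0 h1, Ecol_eq 0 0 h0 h0, Ecol_eq 1 1 h1 h1, ee_sub, Phi_apply]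
  split_ifs <;> simp
  ring

lemma u20 {q : ℕ} (h0 : 0 < q) (h1 : 1 < q) (h2 : 2 < q) :
    uCols q 2 (0 : Fin 1) = v3 ⟨0, h0⟩ ⟨1, h1⟩ ⟨2, h2⟩ := by
  simp only [v3, ← Ecol_eq]
  rfl

lemma u30 {q : ℕ} (h0 : 0 < q) (h1 : 1 < q) (h2 : 2 < q) (h3 : 3 < q) :
    uCols q 3 (0 : Fin 1) = v4 ⟨0, h0⟩ ⟨1, h1⟩ ⟨2, h2⟩ ⟨3, h3⟩ := by
  simp only [v4, ← Ecol_eq]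
  rfl

end Eqs

/-- for `q ≥ 4`, the set `{B₁, B₂, B₃, B₄}` is a representative
set for the natural action of `S_q` on `ℝ^{q×q}` (by simultaneous row and column
permutation); in particular the spans `ℝS_q·B_i(j)` are irreducible
`S_q`-modules, `ℝS_q·B_i(j) ≅ ℝS_q·B_i(j')`, and `ℝS_q·B_i(j) ≇ ℝS_q·B_{i'}(j')`
for `i ≠ i'`. -/
theorem uCols_isRepresentativeSet (q : ℕ) (hq : 4 ≤ q) :
    IsRepresentativeSet (Equiv.Perm (Fin q)) (uCols q) := by
  have hq' : (4 : ℝ) ≤ q := by exact_mod_cast hq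
  have q0 : (q : ℝ) ≠ 0 := by linarith
  have q1 : (q : ℝ) - 1 ≠ 0 := by intro h; linarith
  have q2 : (q : ℝ) - 2 ≠ 0 := by intro h; linarith
  have l0 : 0 < q := by omega
  have l1 : 1 < q := by omega
  have l2 : 2 < q := by omega
  have l3 : 3 < q := by omega
  have e00 := u00 q
  have e01 := u01 q
  have e10 := u10 l0 l1
  have e11 := u11 l0 l1
  have e12 := u12 l0 l1
  have e20 := u20 l0 l1 l2
  have e30 := u30 l0 l1 l2 l3
  have hab : (⟨0, l0⟩ : Fin q) ≠ ⟨1, l1⟩ := by simp [Fin.ext_iff]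
  have hac : (⟨0, l0⟩ : Fin q) ≠ ⟨2, l2⟩ := by simp [Fin.ext_iff]
  have had : (⟨0, l0⟩ : Fin q) ≠ ⟨3, l3⟩ := by simp [Fin.ext_iff]
  have hbc : (⟨1, l1⟩ : Fin q) ≠ ⟨2, l2⟩ := by simp [Fin.ext_iff]
  have hbd : (⟨1, l1⟩ : Fin q) ≠ ⟨3, l3⟩ := by simp [Fin.ext_iff]
  have hcd : (⟨2, l2⟩ : Fin q) ≠ ⟨3, l3⟩ := by simp [Fin.ext_iff]
  generalize (⟨0, l0⟩ : Fin q) = a at *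
  generalize (⟨1, l1⟩ : Fin q) = b at *
  generalize (⟨2, l2⟩ : Fin q) = c at *
  generalize (⟨3, l3⟩ : Fin q) = d at *
  -- left inverses
  have s00 : ∃ r e, Psi r e (Phi 0 0 1 (fun _ => 1)) = (fun _ : Fin q => (1 : ℝ)) :=
    ⟨0, 1, Psi_Phi_one (by ring)⟩
  have s01 : ∃ r e, Psi r e (Phi (1/2) (1/2) (-1) (fun _ => 1)) = (fun _ : Fin q => (1 : ℝ)) :=
    ⟨((q : ℝ) - 1)⁻¹, 0, Psi_Phi_one (by field_simp; ring)⟩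
  have s10 : ∃ r e, Psi r e (Phi 0 0 1 (dd a b)) = dd a b :=
    ⟨0, 1, Psi_Phi (by ring) _ (by simp)⟩
  have s11 : ∃ r e, Psi r e (Phi 1 (-1) 0 (dd a b)) = dd a b :=
    ⟨(q : ℝ)⁻¹, 0, Psi_Phi (by field_simp; ring) _ (by rw [dd_sum, mul_zero])⟩
  have s12 : ∃ r e, Psi r e (Phi 1 1 (-2) (dd a b)) = dd a b :=
    ⟨((q : ℝ) - 2)⁻¹, 0, Psi_Phi (by field_simp; ring) _ (by rw [dd_sum, mul_zero])⟩
  -- nonvanishing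
  have hone : (fun _ : Fin q => (1 : ℝ)) ≠ 0 := fun h => one_ne_zero (congrFun h a)
  have hdd : dd a b ≠ 0 := by
    intro h
    have := congrFun h a
    simp [dd, hab] at this
  have n20 : v3 a b c ≠ 0 := by
    intro h
    have := congrFun h (a, b)
    simp [v3, ee_apply, hab, hac, hbc, hab.symm] at this
  have n30 : v4 a b c d ≠ 0 := by
    intro h
    have := congrFun h (a, c)
    simp [v4, ee_apply, hab, hac, had, hac.symm, hbc.symm, hcd] at this
  have n10 := ne_zero_of hdd s10
  have n11 := ne_zero_of hdd s11
  have n12 := ne_zero_of hdd s12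
  -- containments
  have c00 : orbSpan (SG q) (Phi 0 0 1 (fun _ => 1) : VV q) ≤ UC 0 0 1 :=
    orbSpan_le (UC_invt _ _ _) ⟨1, rfl⟩
  have c01 : orbSpan (SG q) (Phi (1/2) (1/2) (-1) (fun _ => 1) : VV q) ≤ UC (1/2) (1/2) (-1) :=
    orbSpan_le (UC_invt _ _ _) ⟨1, rfl⟩
  have c10 : orbSpan (SG q) (Phi 0 0 1 (dd a b)) ≤ UZ 0 0 1 :=
    orbSpan_le (UZ_invt _ _ _) ⟨_, dd_sum a b, rfl⟩
  have c11 : orbSpan (SG q) (Phi 1 (-1) 0 (dd a b)) ≤ UZ 1 (-1) 0 :=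
    orbSpan_le (UZ_invt _ _ _) ⟨_, dd_sum a b, rfl⟩
  have c12 : orbSpan (SG q) (Phi 1 1 (-2) (dd a b)) ≤ UZ 1 1 (-2) :=
    orbSpan_le (UZ_invt _ _ _) ⟨_, dd_sum a b, rfl⟩
  have c20 : orbSpan (SG q) (v3 a b c) ≤ US (-1) := orbSpan_le (US_invt _) (v3_mem hab hac hbc)
  have c30 : orbSpan (SG q) (v4 a b c d) ≤ US 1 := orbSpan_le (US_invt _) (v4_mem hac had hbc hbd)
  -- annihilation
  have k1 : ∀ β γ δ : ℝ, ∀ f ∈ orbSpan (SG q) (Phi β γ δ (fun _ => 1) : VV q), T1 a b f = 0 := by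
    intro β γ δ f hf
    obtain ⟨t, rfl⟩ := orbSpan_le (UC_invt β γ δ) ⟨1, rfl⟩ hf
    rw [T1_Phi, sub_self, zero_smul]
  have k3 : ∀ (β γ δ : ℝ) (x : Fin q → ℝ), ∀ f ∈ orbSpan (SG q) (Phi β γ δ x),
      T3 a b c f = 0 := by
    intro β γ δ x f hf
    have : orbSpan (SG q) (Phi β γ δ x) ≤ LinearMap.ker (T3 a b c) := by
      refine Submodule.span_le.2 ?_
      rintro _ ⟨g, rfl⟩
      simp only [act_Phi]
      exact T3_Phi hab hac hbc β γ δ _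
    exact this hf
  have k4 : ∀ (β γ δ : ℝ) (x : Fin q → ℝ), ∀ f ∈ orbSpan (SG q) (Phi β γ δ x),
      T4 a b c d f = 0 := by
    intro β γ δ x f hf
    have : orbSpan (SG q) (Phi β γ δ x) ≤ LinearMap.ker (T4 a b c d) := by
      refine Submodule.span_le.2 ?_
      rintro _ ⟨g, rfl⟩
      simp only [act_Phi]
      exact T4_Phi hac had hbc hbd β γ δ _
    exact this hf
  have k34 : ∀ f ∈ orbSpan (SG q) (v4 a b c d), T3 a b c f = 0 := by
    intro f hf
    have h := (c30 hf).1
    rw [T3_apply hab hac hbc, h a b, h b c, h a c]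
    convert zero_smul ℝ _ using 2
    ring
  have m1 : ∀ β γ δ : ℝ, Phi β γ δ (dd a b) ≠ 0 → T1 a b (Phi β γ δ (dd a b)) ≠ 0 := by
    intro β γ δ h
    rw [T1_dd hab]
    exact smul_ne_zero two_ne_zero h
  have m13 : T1 a b (v3 a b c) ≠ 0 := by
    rw [T1_v3 hac hbc]; exact smul_ne_zero two_ne_zero n20
  have m14 : T1 a b (v4 a b c d) ≠ 0 := by
    rw [T1_v4 hac had hbc hbd]; exact smul_ne_zero two_ne_zero n30
  have m3 : T3 a b c (v3 a b c) ≠ 0 := by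
    rw [T3_v3 hab hac hbc]; exact smul_ne_zero (by norm_num) n20
  have m4 : T4 a b c d (v4 a b c d) ≠ 0 := by
    rw [T4_v4 hab hac had hbc hbd hcd]; exact smul_ne_zero (by norm_num) n30
  refine ⟨?_, ?_, ?_, ?_, ?_, ?_⟩
  · apply forall_idx
    · rw [e00]; exact ne_zero_of hone s00
    · rw [e01]; exact ne_zero_of hone s01
    · rw [e10]; exact n10
    · rw [e11]; exact n11
    · rw [e12]; exact n12
    · rw [e20]; exact n20
    · rw [e30]; exact n30
  · apply forall_idx
    · rw [e00]; exact irr_C _ _ _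
    · rw [e01]; exact irr_C _ _ _
    · rw [e10]; exact irr_Z hab _ _ _
    · rw [e11]; exact irr_Z hab _ _ _
    · rw [e12]; exact irr_Z hab _ _ _
    · rw [e20]
      exact irr (T3_good a b c) (by norm_num) (T3_v3 hab hac hbc)
        (fun f _ => ⟨_, T3_apply hab hac hbc f⟩) (T3_sa a b c)
    · rw [e30]
      exact irr (T4_good a b c d) (by norm_num) (T4_v4 hab hac had hbc hbd hcd)
        (fun f hf => ⟨_, T4_apply hab hac had hbc hbd hcd f
          (fun i j => by simpa using (c30 hf).1 i j)⟩) (T4_sa hac had hbc hbd)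
  · intro i
    fin_cases i
    · intro j j'
      change Fin 2 at j j'
      have H : ∀ j : Fin 2, ∃ β γ δ, uCols q 0 j = Phi β γ δ (fun _ => 1) ∧
          ∃ r e, Psi r e (Phi β γ δ (fun _ => 1)) = (fun _ : Fin q => (1 : ℝ)) := by
        intro j
        fin_cases j
        exacts [⟨_, _, _, e00, s00⟩, ⟨_, _, _, e01, s01⟩]
      obtain ⟨β, γ, δ, h1, h2⟩ := H j
      obtain ⟨β', γ', δ', h1', h2'⟩ := H j'
      have := iso_of h2 h2'
      rw [← h1, ← h1'] at this
      exact this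
    · intro j j'
      change Fin 3 at j j'
      have H : ∀ j : Fin 3, ∃ β γ δ, uCols q 1 j = Phi β γ δ (dd a b) ∧
          ∃ r e, Psi r e (Phi β γ δ (dd a b)) = dd a b := by
        intro j
        fin_cases j
        exacts [⟨_, _, _, e10, s10⟩, ⟨_, _, _, e11, s11⟩, ⟨_, _, _, e12, s12⟩]
      obtain ⟨β, γ, δ, h1, h2⟩ := H j
      obtain ⟨β', γ', δ', h1', h2'⟩ := H j'
      have := iso_of h2 h2'
      rw [← h1, ← h1'] at this
      exact this
    · intro j j'
      change Fin 1 at j j'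
      obtain rfl : j = j' := Subsingleton.elim _ _
      exact iso_aux (φ := LinearMap.id) (ψ := LinearMap.id) (fun _ _ => rfl) (fun _ _ => rfl)
        rfl rfl
    · intro j j'
      change Fin 1 at j j'
      obtain rfl : j = j' := Subsingleton.elim _ _
      exact iso_aux (φ := LinearMap.id) (ψ := LinearMap.id) (fun _ _ => rfl) (fun _ _ => rfl)
        rfl rfl
  · have H1 : ∀ j : Fin 2, ∃ β γ δ, uCols q 0 j = Phi β γ δ (fun _ => 1) := by
      intro j
      fin_cases j
      exacts [⟨_, _, _, e00⟩, ⟨_, _, _, e01⟩]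
    have H2 : ∀ j : Fin 3, ∃ β γ δ, uCols q 1 j = Phi β γ δ (dd a b) ∧
        Phi β γ δ (dd a b) ≠ 0 := by
      intro j
      fin_cases j
      exacts [⟨_, _, _, e10, n10⟩, ⟨_, _, _, e11, n11⟩, ⟨_, _, _, e12, n12⟩]
    have H3 : ∀ j : Fin 1, uCols q 2 j = v3 a b c := by
      intro j
      obtain rfl : j = 0 := Subsingleton.elim _ _
      exact e20
    have H4 : ∀ j : Fin 1, uCols q 3 j = v4 a b c d := by
      intro j
      obtain rfl : j = 0 := Subsingleton.elim _ _
      exact e30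
    have A : ∀ i i' : Fin 4, i < i' → ∀ j j', ∃ T, Good T ∧
        ((T (uCols q i j) ≠ 0 ∧ ∀ f ∈ orbSpan (SG q) (uCols q i' j'), T f = 0) ∨
        (T (uCols q i' j') ≠ 0 ∧ ∀ f ∈ orbSpan (SG q) (uCols q i j), T f = 0)) := by
      intro i i' hi j j'
      fin_cases i <;> fin_cases i' <;> first | exact absurd hi (by decide) | skip
      · obtain ⟨β, γ, δ, h⟩ := H1 j
        obtain ⟨β', γ', δ', h', n⟩ := H2 j'
        refine ⟨_, T1_good a b, Or.inr ⟨?_, ?_⟩⟩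
        · erw [h']; exact m1 _ _ _ n
        · erw [h]; exact k1 _ _ _
      · obtain ⟨β, γ, δ, h⟩ := H1 j
        refine ⟨_, T1_good a b, Or.inr ⟨?_, ?_⟩⟩
        · erw [H3 j']; exact m13
        · erw [h]; exact k1 _ _ _
      · obtain ⟨β, γ, δ, h⟩ := H1 j
        refine ⟨_, T1_good a b, Or.inr ⟨?_, ?_⟩⟩
        · erw [H4 j']; exact m14
        · erw [h]; exact k1 _ _ _
      · obtain ⟨β, γ, δ, h, n⟩ := H2 j
        refine ⟨_, T3_good a b c, Or.inr ⟨?_, ?_⟩⟩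
        · erw [H3 j']; exact m3
        · erw [h]; exact k3 _ _ _ _
      · obtain ⟨β, γ, δ, h, n⟩ := H2 j
        refine ⟨_, T4_good a b c d, Or.inr ⟨?_, ?_⟩⟩
        · erw [H4 j']; exact m4
        · erw [h]; exact k4 _ _ _ _
      · refine ⟨_, T3_good a b c, Or.inl ⟨?_, ?_⟩⟩
        · erw [H3 j]; exact m3
        · erw [H4 j']; exact k34
    intro i i' hi j j'
    rcases lt_or_gt_of_ne hi with h | h
    · obtain ⟨T, hT, hh⟩ := A i i' h j j'
      exact noniso hT hh
    · obtain ⟨T, hT, hh⟩ := A i' i h j' j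
      exact noniso hT hh.symm
  · apply indep_of_dot
    have o1 := (orth_CC (q := q)).mono c00 c01
    have o2 := (orth_CZ (q := q) _ _ _ _ _ _).mono c00 c10
    have o3 := (orth_CZ (q := q) _ _ _ _ _ _).mono c00 c11
    have o4 := (orth_CZ (q := q) _ _ _ _ _ _).mono c00 c12
    have o5 := (orth_CZ (q := q) _ _ _ _ _ _).mono c01 c10
    have o6 := (orth_CZ (q := q) _ _ _ _ _ _).mono c01 c11
    have o7 := (orth_CZ (q := q) _ _ _ _ _ _).mono c01 c12
    have o8 := (orth_ZZ (q := q) (by ring)).mono c10 c11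
    have o9 := (orth_ZZ (q := q) (by ring)).mono c10 c12
    have o10 := (orth_ZZ (q := q) (by ring)).mono c11 c12
    have o11 := (orth_SC (q := q) _ _ _ _).mono c20 c00
    have o12 := (orth_SC (q := q) _ _ _ _).mono c20 c01
    have o13 := (orth_SZ (q := q) _ _ _ _).mono c20 c10
    have o14 := (orth_SZ (q := q) _ _ _ _).mono c20 c11
    have o15 := (orth_SZ (q := q) _ _ _ _).mono c20 c12
    have o16 := (orth_SC (q := q) _ _ _ _).mono c30 c00
    have o17 := (orth_SC (q := q) _ _ _ _).mono c30 c01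
    have o18 := (orth_SZ (q := q) _ _ _ _).mono c30 c10
    have o19 := (orth_SZ (q := q) _ _ _ _).mono c30 c11
    have o20 := (orth_SZ (q := q) _ _ _ _).mono c30 c12
    have o21 := (orth_SS (q := q)).mono c20 c30
    have main : ∀ i j i' j', (⟨i, j⟩ : Σ i : Fin 4, Fin (![2, 3, 1, 1] i)) ≠ ⟨i', j'⟩ →
        Orth (orbSpan (SG q) (uCols q i j)) (orbSpan (SG q) (uCols q i' j')) := by
      apply forall_idx <;> apply forall_idx <;> intro hne <;>
        first
        | exact absurd rfl hne
        | (simp only [e00, e01, e10, e11, e12, e20, e30]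
           first
           | with_reducible assumption
           | (apply Orth.symm; with_reducible assumption))
    rintro ⟨i, j⟩ ⟨i', j'⟩ h
    exact main i j i' j' h
  · apply top_of_dot
    intro f hf
    have H : ∀ (i : Fin 4) (j : Fin (![2, 3, 1, 1] i)) (g : SG q),
        f ⬝ᵥ actF (SG q) g (uCols q i j) = 0 := by
      intro i j g
      apply hf
      exact (le_iSup (fun p : Σ i : Fin 4, Fin (![2, 3, 1, 1] i) =>
        orbSpan (SG q) (uCols q p.1 p.2)) ⟨i, j⟩) (act_mem_orbSpan g _)
    refine final_zero hq hab hac had hbc hbd hcd f ?_ ?_ ?_ ?_ ?_ ?_ ?_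
    · rw [← e00]; exact H 0 _
    · rw [← e01]; exact H 0 _
    · rw [← e10]; exact H 1 _
    · rw [← e11]; exact H 1 _
    · rw [← e12]; exact H 1 _
    · rw [← e20]; exact H 2 _
    · rw [← e30]; exact H 3 _
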